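/- For every 1 ≤ r ≤ N−2 and all i, j ∈ {1,2,3,4}, ‖[[T_r^(i), T_{r+1}^(j)], D_{r+1}]‖ ≤ x²·(μ/2 + Λ + 1/2). -/

import Mathlib

open Matrix Complex

noncomputable section

/-- The spectral (ℓ²-operator) norm of a complex square matrix. -/
def specNorm {n : Type*} [Fintype n] [DecidableEq n] (M : Matrix n n ℂ) : ℝ :=
  ‖Matrix.toEuclideanCLM (𝕜 := ℂ) M‖

/-- Pauli X. -/
def PX : Matrix (Fin 2) (Fin 2) ℂ := !![0, 1; 1, 0]
/-- Pauli Y. -/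
def PY : Matrix (Fin 2) (Fin 2) ℂ := !![0, -I; I, 0]
/-- Pauli Z. -/
def PZ : Matrix (Fin 2) (Fin 2) ℂ := !![1, 0; 0, -1]

/-- Electric field operator `E |j⟩ = (j - Λ)|j⟩` on `ℂ^(2^η)`, `Λ = 2^(η-1)`. -/
def Eop (η : ℕ) : Matrix (Fin (2 ^ η)) (Fin (2 ^ η)) ℂ :=
  Matrix.diagonal fun j => ((j : ℕ) : ℂ) - ((2 ^ (η - 1) : ℕ) : ℂ)

/-- Link operator `U |j⟩ = |j + 1 mod 2^η⟩`. -/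
def Uop (η : ℕ) : Matrix (Fin (2 ^ η)) (Fin (2 ^ η)) ℂ :=
  Matrix.of fun j k => if (j : ℕ) = ((k : ℕ) + 1) % 2 ^ η then 1 else 0

/-- `A |j⟩ = |j XOR 1⟩`. -/
def Aop (η : ℕ) : Matrix (Fin (2 ^ η)) (Fin (2 ^ η)) ℂ :=
  Matrix.of fun j k => if (j : ℕ) = (k : ℕ) ^^^ 1 then 1 else 0

/-- `B |j⟩ = i (-1)^j |j XOR 1⟩`. -/
def Bop (η : ℕ) : Matrix (Fin (2 ^ η)) (Fin (2 ^ η)) ℂ :=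
  Matrix.of fun j k => if (j : ℕ) = (k : ℕ) ^^^ 1 then I * (-1) ^ (k : ℕ) else 0

/-- Configurations of the lattice: a qubit for each of the `N` sites (0-indexed; the paper's
site `r` is index `r - 1`) and a `2^η`-dimensional register for each of the `N - 1` links
(0-indexed; the paper's link `r` is index `r - 1`). -/
abbrev Config (N η : ℕ) := (Fin N → Fin 2) × (Fin (N - 1) → Fin (2 ^ η))

/-- Operators on the lattice Hilbert space `(ℂ²)^{⊗N} ⊗ (ℂ^{2Λ})^{⊗(N-1)}`. -/
abbrev LatOp (N η : ℕ) := Matrix (Config N η) (Config N η) ℂ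

/-- A single-qubit operator `M` acting on the `r`-th site factor. -/
def siteOp (N η : ℕ) (r : Fin N) (M : Matrix (Fin 2) (Fin 2) ℂ) : LatOp N η :=
  Matrix.of fun p q =>
    if p.2 = q.2 ∧ ∀ s, s ≠ r → p.1 s = q.1 s then M (p.1 r) (q.1 r) else 0

/-- A single-link operator `M` acting on the `r`-th link factor. -/
def linkOp (N η : ℕ) (r : Fin (N - 1)) (M : Matrix (Fin (2 ^ η)) (Fin (2 ^ η)) ℂ) :
    LatOp N η :=
  Matrix.of fun p q =>
    if p.1 = q.1 ∧ ∀ s, s ≠ r → p.2 s = q.2 s then M (p.2 r) (q.2 r) else 0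

/-- For the `r`-th link (0-indexed), the site on its left, as an index into `Fin N`. -/
def siteL {N : ℕ} (r : Fin (N - 1)) : Fin N := ⟨r.1, by have := r.2; omega⟩

/-- For the `r`-th link (0-indexed), the site on its right, as an index into `Fin N`. -/
def siteR {N : ℕ} (r : Fin (N - 1)) : Fin N := ⟨r.1 + 1, by have := r.2; omega⟩

/-- `X_r X_{r+1} + Y_r Y_{r+1}` (paper indices; `r` is the 0-indexed link). -/
def Gop (N η : ℕ) (r : Fin (N - 1)) : LatOp N η :=
  siteOp N η (siteL r) PX * siteOp N η (siteR r) PX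
    + siteOp N η (siteL r) PY * siteOp N η (siteR r) PY

/-- `X_r Y_{r+1} - Y_r X_{r+1}` (paper indices; `r` is the 0-indexed link). -/
def Gtilde (N η : ℕ) (r : Fin (N - 1)) : LatOp N η :=
  siteOp N η (siteL r) PX * siteOp N η (siteR r) PY
    - siteOp N η (siteL r) PY * siteOp N η (siteR r) PX

/-- The four hopping terms `T_r^(1), …, T_r^(4)` (`j = 0,…,3` is the paper's `j = 1,…,4`;
`r` is the 0-indexed link, the paper's site/link `r+1`). -/
def Thop (N η : ℕ) (x : ℝ) (r : Fin (N - 1)) : Fin 4 → LatOp N η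
  | 0 => ((x : ℂ) / 4) • (linkOp N η r (Aop η) * Gop N η r)
  | 1 => ((x : ℂ) / 4) • (linkOp N η r ((Uop η)ᴴ * Aop η * Uop η) * Gop N η r)
  | 2 => ((x : ℂ) / 4) • (linkOp N η r ((Uop η)ᴴ * Bop η * Uop η) * Gtilde N η r)
  | 3 => ((x : ℂ) / 4) • (linkOp N η r (Bop η) * Gtilde N η r)

/-- Mass term `D_r^(M) = -(μ/2) (-1)^r Z_r` at the 0-indexed site `i` (paper's site `r = i+1`). -/
def DM (N η : ℕ) (μ : ℝ) (i : Fin N) : LatOp N η :=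
  ((-(μ : ℂ) / 2) * (-1) ^ ((i : ℕ) + 1)) • siteOp N η i PZ

/-- Electric term `D_r^(E) = E_r²` at the 0-indexed link `r`. -/
def DE (N η : ℕ) (r : Fin (N - 1)) : LatOp N η := (linkOp N η r (Eop η)) ^ 2

/-- `D_r = D_r^(M) + D_r^(E)` for the paper's `1 ≤ r ≤ N - 1` (`r` the 0-indexed link). -/
def Dlink (N η : ℕ) (μ : ℝ) (r : Fin (N - 1)) : LatOp N η :=
  DM N η μ (siteL r) + DE N η r

end


open scoped Matrix.Norms.L2Operator in
theorem specNorm_eq_norm {n : Type*} [Fintype n] [DecidableEq n] (M : Matrix n n ℂ) :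
    specNorm M = ‖M‖ := rfl

section LocalOperators

/-- The operator on `(ℂ^α)^{⊗ι}` acting as `M` on the `r`-th factor. -/
def localOp {ι α : Type*} [Fintype ι] [DecidableEq ι] [DecidableEq α] (r : ι)
    (M : Matrix α α ℂ) : Matrix (ι → α) (ι → α) ℂ :=
  Matrix.of fun p q => if ∀ s, s ≠ r → p s = q s then M (p r) (q r) else 0

variable {ι α : Type*} [Fintype ι] [DecidableEq ι] [DecidableEq α]

theorem localOp_mul [Fintype α] (r : ι) (A B : Matrix α α ℂ) :
    localOp r (A * B) = localOp r A * localOp r B := by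
  ext p q
  simp only [localOp, Matrix.mul_apply, Matrix.of_apply]
  split_ifs with hpq
  · refine Finset.sum_of_injOn (Function.update p r) (Function.update_injective p r).injOn
      (by simp) ?_ ?_
    · intro s _ hs
      rw [if_neg, zero_mul]
      intro hps
      refine hs ⟨s r, by simp, ?_⟩
      ext t
      by_cases ht : t = r
      · subst ht; simp
      · simp [ht, hps t ht]
    · intro a _
      rw [if_pos, if_pos]
      · simp
      · intro s hs; simp [hs, hpq s hs]
      · intro s hs; simp [hs]
  · symm
    refine Finset.sum_eq_zero fun s _ => ?_
    split_ifs with h1 h2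
    · exact absurd (fun t ht => (h1 t ht).trans (h2 t ht)) hpq
    all_goals simp

theorem localOp_diagonal (r : ι) (d : α → ℂ) :
    localOp r (Matrix.diagonal d) = Matrix.diagonal fun p => d (p r) := by
  ext p q
  simp only [localOp, Matrix.of_apply, Matrix.diagonal_apply]
  by_cases hpq : p = q
  · simp [hpq]
  · rw [if_neg hpq]
    split_ifs with h1 h2
    · exact absurd (funext fun s => if hs : s = r then hs ▸ h2 else h1 s hs) hpq
    all_goals rfl

theorem localOp_conjTranspose (r : ι) (M : Matrix α α ℂ) :
    localOp r Mᴴ = (localOp r M)ᴴ := by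
  ext p q
  simp only [localOp, Matrix.of_apply, Matrix.conjTranspose_apply, eq_comm (a := p _)]
  split_ifs <;> simp

end LocalOperators

theorem siteOp_eq_kronecker (N η : ℕ) (r : Fin N) (M : Matrix (Fin 2) (Fin 2) ℂ) :
    siteOp N η r M = kroneckerMap (· * ·) (localOp r M) 1 := by
  ext p q
  simp only [siteOp, localOp, Matrix.of_apply, Matrix.kroneckerMap_apply, Matrix.one_apply]
  by_cases h : p.2 = q.2 <;> simp [h]

theorem linkOp_eq_kronecker (N η : ℕ) (r : Fin (N - 1))
    (M : Matrix (Fin (2 ^ η)) (Fin (2 ^ η)) ℂ) :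
    linkOp N η r M = kroneckerMap (· * ·) 1 (localOp r M) := by
  ext p q
  simp only [linkOp, localOp, Matrix.of_apply, Matrix.kroneckerMap_apply, Matrix.one_apply]
  by_cases h : p.1 = q.1 <;> simp [h]

theorem linkOp_mul (N η : ℕ) (r : Fin (N - 1)) (A B : Matrix (Fin (2 ^ η)) (Fin (2 ^ η)) ℂ) :
    linkOp N η r (A * B) = linkOp N η r A * linkOp N η r B := by
  simp only [linkOp_eq_kronecker, localOp_mul]
  rw [← Matrix.mul_kronecker_mul, one_mul]

theorem linkOp_sub (N η : ℕ) (r : Fin (N - 1)) (A B : Matrix (Fin (2 ^ η)) (Fin (2 ^ η)) ℂ) :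
    linkOp N η r (A - B) = linkOp N η r A - linkOp N η r B := by
  ext p q
  simp only [linkOp, Matrix.of_apply, Matrix.sub_apply]
  split_ifs <;> simp

theorem linkOp_diagonal (N η : ℕ) (r : Fin (N - 1)) (d : Fin (2 ^ η) → ℂ) :
    linkOp N η r (Matrix.diagonal d) = Matrix.diagonal fun p => d (p.2 r) := by
  rw [linkOp_eq_kronecker, localOp_diagonal, ← Matrix.diagonal_one,
    Matrix.diagonal_kronecker_diagonal]
  simp

theorem linkOp_commute_diagonal (N η : ℕ) {r s : Fin (N - 1)} (hrs : s ≠ r)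
    (M : Matrix (Fin (2 ^ η)) (Fin (2 ^ η)) ℂ) (d : Fin (2 ^ η) → ℂ) :
    Commute (linkOp N η r M) (Matrix.diagonal fun p => d (p.2 s)) := by
  ext p q
  simp only [linkOp, Matrix.mul_diagonal, Matrix.diagonal_mul, Matrix.of_apply]
  split_ifs with h
  · rw [h.2 s hrs, mul_comm]
  · simp

theorem siteOp_commute_diagonal (N η : ℕ) (r : Fin N) (s : Fin (N - 1))
    (M : Matrix (Fin 2) (Fin 2) ℂ) (d : Fin (2 ^ η) → ℂ) :
    Commute (siteOp N η r M) (Matrix.diagonal fun p => d (p.2 s)) := by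
  ext p q
  simp only [siteOp, Matrix.mul_diagonal, Matrix.diagonal_mul, Matrix.of_apply]
  split_ifs with h
  · rw [h.1, mul_comm]
  · simp

theorem Gop_commute_diagonal (N η : ℕ) (r s : Fin (N - 1)) (d : Fin (2 ^ η) → ℂ) :
    Commute (Gop N η r) (Matrix.diagonal fun p => d (p.2 s)) := by
  have h := fun t M => siteOp_commute_diagonal N η t s M d
  exact ((h _ _).mul_left (h _ _)).add_left ((h _ _).mul_left (h _ _))

theorem Gtilde_commute_diagonal (N η : ℕ) (r s : Fin (N - 1)) (d : Fin (2 ^ η) → ℂ) :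
    Commute (Gtilde N η r) (Matrix.diagonal fun p => d (p.2 s)) := by
  have h := fun t M => siteOp_commute_diagonal N η t s M d
  exact ((h _ _).mul_left (h _ _)).sub_left ((h _ _).mul_left (h _ _))

theorem DE_eq_diagonal (N η : ℕ) (r : Fin (N - 1)) :
    DE N η r = Matrix.diagonal fun p =>
      (((p.2 r : ℕ) : ℂ) - ((2 ^ (η - 1) : ℕ) : ℂ)) ^ 2 := by
  rw [DE, Eop, linkOp_diagonal, Matrix.diagonal_pow]
  rfl

/-- `M` permutes the basis up to phases, and the values of the squared electric field on any two
basis vectors it connects differ by at most `2Λ - 1`. -/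
def IsHoppingMatrix (η : ℕ) (M : Matrix (Fin (2 ^ η)) (Fin (2 ^ η)) ℂ) : Prop :=
  ∃ (f : Fin (2 ^ η) → Fin (2 ^ η)) (φ : Fin (2 ^ η) → ℂ), Function.Injective f ∧
    (∀ k, ‖φ k‖ = 1) ∧ (M = Matrix.of fun j k => if j = f k then φ k else 0) ∧
    ∀ k : Fin (2 ^ η), |(((k : ℕ) : ℝ) - ((2 ^ (η - 1) : ℕ) : ℝ)) ^ 2
      - (((f k : ℕ) : ℝ) - ((2 ^ (η - 1) : ℕ) : ℝ)) ^ 2| ≤ 2 * ((2 ^ (η - 1) : ℕ) : ℝ) - 1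

section Norms

open scoped Matrix.Norms.L2Operator

theorem norm_le_one_of_conjTranspose_mul_self {n : Type*} [Fintype n] [DecidableEq n]
    {M : Matrix n n ℂ} (h : Mᴴ * M = 1) : ‖M‖ ≤ 1 := by
  have h1 : ‖M‖ * ‖M‖ = ‖(1 : Matrix n n ℂ)‖ := by
    rw [← h]; exact (Matrix.l2_opNorm_conjTranspose_mul_self M).symm
  have h2 : ‖(1 : Matrix n n ℂ)‖ ≤ 1 := by
    rw [← Matrix.diagonal_one, Matrix.l2_opNorm_diagonal]
    exact (pi_norm_le_iff_of_nonneg zero_le_one).2 fun i => by simp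
  nlinarith [norm_nonneg M]

theorem norm_siteOp_le_one (N η : ℕ) (r : Fin N) {M : Matrix (Fin 2) (Fin 2) ℂ}
    (h : Mᴴ * M = 1) : ‖siteOp N η r M‖ ≤ 1 := by
  apply norm_le_one_of_conjTranspose_mul_self
  rw [siteOp_eq_kronecker, Matrix.conjTranspose_kronecker, ← Matrix.mul_kronecker_mul,
    ← localOp_conjTranspose, ← localOp_mul, h, ← Matrix.diagonal_one, localOp_diagonal]
  simp

theorem norm_linkOp_le_one (N η : ℕ) (r : Fin (N - 1))
    {M : Matrix (Fin (2 ^ η)) (Fin (2 ^ η)) ℂ} (h : Mᴴ * M = 1) : ‖linkOp N η r M‖ ≤ 1 := by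
  apply norm_le_one_of_conjTranspose_mul_self
  rw [linkOp_eq_kronecker, Matrix.conjTranspose_kronecker, ← Matrix.mul_kronecker_mul,
    ← localOp_conjTranspose, ← localOp_mul, h, ← Matrix.diagonal_one (n := Fin (2 ^ η)), localOp_diagonal]
  simp

theorem PX_conjTranspose_mul_self : PXᴴ * PX = 1 := by
  ext i j; fin_cases i <;> fin_cases j <;> simp [PX, Matrix.mul_apply]

theorem PY_conjTranspose_mul_self : PYᴴ * PY = 1 := by
  ext i j; fin_cases i <;> fin_cases j <;> simp [PY, Matrix.mul_apply]

theorem PZ_conjTranspose_mul_self : PZᴴ * PZ = 1 := by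
  ext i j; fin_cases i <;> fin_cases j <;> simp [PZ, Matrix.mul_apply]

theorem norm_Gop_le (N η : ℕ) (r : Fin (N - 1)) : ‖Gop N η r‖ ≤ 2 := by
  have hX := fun t => norm_siteOp_le_one N η t PX_conjTranspose_mul_self
  have hY := fun t => norm_siteOp_le_one N η t PY_conjTranspose_mul_self
  have h1 := norm_mul_le_of_le (hX (siteL r)) (hX (siteR r))
  have h2 := norm_mul_le_of_le (hY (siteL r)) (hY (siteR r))
  exact (norm_add_le_of_le h1 h2).trans (by norm_num)

theorem norm_Gtilde_le (N η : ℕ) (r : Fin (N - 1)) : ‖Gtilde N η r‖ ≤ 2 := by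
  have hX := fun t => norm_siteOp_le_one N η t PX_conjTranspose_mul_self
  have hY := fun t => norm_siteOp_le_one N η t PY_conjTranspose_mul_self
  have h1 := norm_mul_le_of_le (hX (siteL r)) (hY (siteR r))
  have h2 := norm_mul_le_of_le (hY (siteL r)) (hX (siteR r))
  exact (norm_sub_le_of_le h1 h2).trans (by norm_num)

theorem norm_DM_le (N η : ℕ) {μ : ℝ} (hμ : 0 ≤ μ) (i : Fin N) : ‖DM N η μ i‖ ≤ μ / 2 := by
  have hZ := norm_siteOp_le_one N η i PZ_conjTranspose_mul_self
  rw [DM, norm_smul]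
  have : ‖(-(μ : ℂ) / 2) * (-1) ^ ((i : ℕ) + 1)‖ = μ / 2 := by
    simp [abs_of_nonneg hμ]
  rw [this]
  exact mul_le_of_le_one_right (by positivity) hZ

theorem IsHoppingMatrix.conjTranspose_mul_self {η : ℕ}
    {M : Matrix (Fin (2 ^ η)) (Fin (2 ^ η)) ℂ} (hM : IsHoppingMatrix η M) : Mᴴ * M = 1 := by
  obtain ⟨f, φ, hf, hφ, rfl, -⟩ := hM
  ext p q
  simp only [Matrix.mul_apply, Matrix.conjTranspose_apply, Matrix.of_apply, Matrix.one_apply]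
  rw [Finset.sum_eq_single (f q) (fun b _ hb => by simp [hb]) (by simp)]
  by_cases hpq : p = q
  · subst hpq
    simp [← Complex.normSq_eq_conj_mul_self, Complex.normSq_eq_norm_sq, hφ]
  · simp [hpq, hf.eq_iff, Ne.symm hpq]

theorem IsHoppingMatrix.norm_commutator_DE_le {η : ℕ}
    {M : Matrix (Fin (2 ^ η)) (Fin (2 ^ η)) ℂ} (hM : IsHoppingMatrix η M) (N : ℕ)
    (r : Fin (N - 1)) :
    ‖linkOp N η r M * DE N η r - DE N η r * linkOp N η r M‖
      ≤ 2 * ((2 ^ (η - 1) : ℕ) : ℝ) - 1 := by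
  have hL := norm_linkOp_le_one N η r hM.conjTranspose_mul_self
  obtain ⟨f, φ, -, -, hMeq, hd⟩ := hM
  have hpos : (0 : ℝ) ≤ 2 * ((2 ^ (η - 1) : ℕ) : ℝ) - 1 := by
    have : (1 : ℝ) ≤ ((2 ^ (η - 1) : ℕ) : ℝ) := by exact_mod_cast Nat.one_le_two_pow
    linarith
  set e : Fin (2 ^ η) → ℝ := fun k => (((k : ℕ) : ℝ) - ((2 ^ (η - 1) : ℕ) : ℝ)) ^ 2 with he
  set d : Fin (2 ^ η) → ℂ := fun k => ((e k - e (f k) : ℝ) : ℂ) with hdd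
  have hE : DE N η r = linkOp N η r (Matrix.diagonal fun k => (e k : ℂ)) := by
    rw [DE_eq_diagonal, linkOp_diagonal]
    simp [he]
  have hcomm : M * Matrix.diagonal (fun k => (e k : ℂ)) - Matrix.diagonal (fun k => (e k : ℂ)) * M
      = M * Matrix.diagonal d := by
    ext j k
    simp only [Matrix.sub_apply, Matrix.mul_diagonal, Matrix.diagonal_mul, hMeq, Matrix.of_apply,
      hdd]
    split_ifs with hjk
    · subst hjk; push_cast; ring
    · simp
  rw [hE, ← linkOp_mul, ← linkOp_mul, ← linkOp_sub, hcomm, linkOp_mul]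
  have hD : ‖linkOp N η r (Matrix.diagonal d)‖ ≤ 2 * ((2 ^ (η - 1) : ℕ) : ℝ) - 1 := by
    rw [linkOp_diagonal, Matrix.l2_opNorm_diagonal]
    refine (pi_norm_le_iff_of_nonneg hpos).2 fun p => ?_
    rw [hdd, Complex.norm_real]
    exact hd _
  simpa using norm_mul_le_of_le hL hD

end Norms

theorem nat_xor_one_cases (k : ℕ) :
    (k % 2 = 0 ∧ k ^^^ 1 = k + 1) ∨ (k % 2 = 1 ∧ (k ^^^ 1) + 1 = k) := by
  rcases Nat.mod_two_eq_zero_or_one k with h | h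
  · left
    exact ⟨h, Nat.xor_one_of_even (Nat.even_iff.2 h)⟩
  · right
    rw [Nat.xor_one_of_odd (Nat.odd_iff.2 h)]
    omega

/-- The involution `j ↦ j XOR 1` of the basis labels. -/
def xorOne (η : ℕ) (hη : 1 ≤ η) (k : Fin (2 ^ η)) : Fin (2 ^ η) :=
  ⟨k ^^^ 1, Nat.xor_lt_two_pow k.2 (Nat.one_lt_two_pow (by omega))⟩

theorem xorOne_injective (η : ℕ) (hη : 1 ≤ η) : Function.Injective (xorOne η hη) := by
  intro a b hab
  have h : (a : ℕ) ^^^ 1 = (b : ℕ) ^^^ 1 := congrArg Fin.val hab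
  exact Fin.ext (Nat.xor_left_injective h)

theorem abs_sq_sub_sq_le_of_adjacent {n Λ k l : ℕ} (hn : n = 2 * Λ) (hk : k < n) (hl : l < n)
    (h : l = k + 1 ∨ k = l + 1 ∨ (k = 0 ∧ l + 1 = n) ∨ (l = 0 ∧ k + 1 = n)) :
    |((k : ℝ) - (Λ : ℝ)) ^ 2 - ((l : ℝ) - (Λ : ℝ)) ^ 2| ≤ 2 * (Λ : ℝ) - 1 := by
  subst hn
  rcases h with rfl | rfl | ⟨rfl, h⟩ | ⟨rfl, h⟩
  · have : ((k + 1 : ℕ) : ℝ) + 1 ≤ ((2 * Λ : ℕ) : ℝ) := by exact_mod_cast hl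
    push_cast at *
    rw [abs_le]; constructor <;> nlinarith [(k.cast_nonneg : (0 : ℝ) ≤ k)]
  · have : ((l + 1 : ℕ) : ℝ) + 1 ≤ ((2 * Λ : ℕ) : ℝ) := by exact_mod_cast hk
    push_cast at *
    rw [abs_le]; constructor <;> nlinarith [(l.cast_nonneg : (0 : ℝ) ≤ l)]
  · have h1 : (1 : ℝ) ≤ (Λ : ℝ) := by exact_mod_cast (by omega : 1 ≤ Λ)
    have : (l : ℝ) = 2 * Λ - 1 := by
      have : ((l + 1 : ℕ) : ℝ) = ((2 * Λ : ℕ) : ℝ) := by rw [h]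
      push_cast at this; linarith
    rw [this, abs_le]; push_cast; constructor <;> nlinarith
  · have h1 : (1 : ℝ) ≤ (Λ : ℝ) := by exact_mod_cast (by omega : 1 ≤ Λ)
    have : (k : ℝ) = 2 * Λ - 1 := by
      have : ((k + 1 : ℕ) : ℝ) = ((2 * Λ : ℕ) : ℝ) := by rw [h]
      push_cast at this; linarith
    rw [this, abs_le]; push_cast; constructor <;> nlinarith

theorem two_pow_eq_two_mul {η : ℕ} (hη : 1 ≤ η) : 2 ^ η = 2 * 2 ^ (η - 1) := by
  rw [← pow_succ', Nat.sub_add_cancel hη]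

theorem isHoppingMatrix_xorOne {η : ℕ} (hη : 1 ≤ η) {φ : Fin (2 ^ η) → ℂ}
    (hφ : ∀ k, ‖φ k‖ = 1) :
    IsHoppingMatrix η (Matrix.of fun j
      (k : Fin (2 ^ η)) => if (j : ℕ) = (k : ℕ) ^^^ 1 then φ k else 0) := by
  refine ⟨xorOne η hη, φ, xorOne_injective η hη, hφ, ?_, fun (k : Fin (2 ^ η)) => ?_⟩
  · ext j k
    simp [xorOne, Fin.ext_iff]
  · refine abs_sq_sub_sq_le_of_adjacent (two_pow_eq_two_mul hη) k.2 (xorOne η hη k).2 ?_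
    have := nat_xor_one_cases k
    simp only [xorOne]
    omega

/-- The cyclic shift `j ↦ j + 1 mod 2^η` of the basis labels. -/
def cyclicShift (η : ℕ) : Equiv.Perm (Fin (2 ^ η)) := Equiv.addRight 1

theorem cyclicShift_val {η : ℕ} (hη : 1 ≤ η) (k : Fin (2 ^ η)) :
    (cyclicShift η k : ℕ) = ((k : ℕ) + 1) % 2 ^ η := by
  have : 1 % 2 ^ η = 1 := Nat.mod_eq_of_lt (Nat.one_lt_two_pow (by omega))
  simp [cyclicShift, Fin.val_add, this]

theorem Uop_conj_eq_submatrix {η : ℕ} (hη : 1 ≤ η) (M : Matrix (Fin (2 ^ η)) (Fin (2 ^ η)) ℂ) :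
    (Uop η)ᴴ * M * Uop η = M.submatrix (cyclicShift η) (cyclicShift η) := by
  have hU : Uop η = Matrix.of fun j k => if j = cyclicShift η k then (1 : ℂ) else 0 := by
    ext j k
    simp [Uop, Fin.ext_iff, cyclicShift_val hη]
  ext j k
  simp [hU, Matrix.mul_apply, Matrix.conjTranspose_apply, apply_ite]

theorem isHoppingMatrix_shift_xorOne {η : ℕ} (hη : 1 ≤ η) {φ : Fin (2 ^ η) → ℂ}
    (hφ : ∀ k, ‖φ k‖ = 1) :
    IsHoppingMatrix η ((Uop η)ᴴ *
      (Matrix.of fun (j k : Fin (2 ^ η)) =>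
        if (j : ℕ) = (k : ℕ) ^^^ 1 then φ k else 0) * Uop η) := by
  set σ := cyclicShift η with hσ
  refine ⟨fun k => σ.symm (xorOne η hη (σ k)), φ ∘ σ, ?_, fun k => hφ _, ?_, fun (k : Fin (2 ^ η)) => ?_⟩
  · exact σ.symm.injective.comp ((xorOne_injective η hη).comp σ.injective)
  · rw [Uop_conj_eq_submatrix hη]
    ext j k
    simp [Equiv.eq_symm_apply, xorOne, Fin.ext_iff, hσ]
  · beta_reduce
    set l := σ.symm (xorOne η hη (σ k)) with hl
    refine abs_sq_sub_sq_le_of_adjacent (two_pow_eq_two_mul hη) k.2 l.2 ?_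
    have h1 : (σ l : ℕ) = (σ k : ℕ) ^^^ 1 := by simp [hl, xorOne]
    have h2 := nat_xor_one_cases (σ k)
    rw [← h1, hσ, cyclicShift_val hη, cyclicShift_val hη] at h2
    have hn := two_pow_eq_two_mul hη
    have key : ∀ m < 2 ^ η, (m + 1) % 2 ^ η = m + 1 ∧ m + 1 < 2 ^ η ∨
        (m + 1) % 2 ^ η = 0 ∧ m + 1 = 2 ^ η := by
      intro m hm
      rcases Nat.lt_or_eq_of_le (Nat.succ_le_of_lt hm) with h | h
      · exact .inl ⟨Nat.mod_eq_of_lt h, h⟩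
      · exact .inr ⟨by rw [← Nat.succ_eq_add_one, h, Nat.mod_self], h⟩
    have hk := key k k.2
    have hl' := key l l.2
    omega

section HoppingTerms

open scoped Matrix.Norms.L2Operator

theorem Thop_eq_smul_mul (N : ℕ) {η : ℕ} (hη : 1 ≤ η) (x : ℝ) (r : Fin (N - 1)) (i : Fin 4) :
    ∃ L G, IsHoppingMatrix η L ∧ ‖G‖ ≤ 2 ∧
      (∀ (s : Fin (N - 1)) (d : Fin (2 ^ η) → ℂ),
        Commute G (Matrix.diagonal fun p : Config N η => d (p.2 s))) ∧
      Thop N η x r i = ((x : ℂ) / 4) • (linkOp N η r L * G) := by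
  have hA : ∀ k : Fin (2 ^ η), ‖(fun _ => 1 : Fin (2 ^ η) → ℂ) k‖ = 1 := by simp
  have hB : ∀ k : Fin (2 ^ η), ‖(fun k => I * (-1) ^ (k : ℕ) : Fin (2 ^ η) → ℂ) k‖ = 1 := by simp
  have hG := Gop_commute_diagonal N η r
  have hG' := Gtilde_commute_diagonal N η r
  fin_cases i
  · exact ⟨_, _, isHoppingMatrix_xorOne hη hA, norm_Gop_le N η r, hG, rfl⟩
  · exact ⟨_, _, isHoppingMatrix_shift_xorOne hη hA, norm_Gop_le N η r, hG, rfl⟩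
  · exact ⟨_, _, isHoppingMatrix_shift_xorOne hη hB, norm_Gtilde_le N η r, hG', rfl⟩
  · exact ⟨_, _, isHoppingMatrix_xorOne hη hB, norm_Gtilde_le N η r, hG', rfl⟩

theorem norm_ofReal_div_four {x : ℝ} (hx : 0 < x) : ‖(x : ℂ) / 4‖ = x / 4 := by
  simp [abs_of_pos hx]

theorem norm_Thop_le (N : ℕ) {η : ℕ} (hη : 1 ≤ η) {x : ℝ} (hx : 0 < x) (r : Fin (N - 1))
    (i : Fin 4) : ‖Thop N η x r i‖ ≤ x / 2 := by
  obtain ⟨L, G, hL, hG, -, hT⟩ := Thop_eq_smul_mul N hη x r i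
  rw [hT, norm_smul, norm_ofReal_div_four hx]
  have := norm_mul_le_of_le (norm_linkOp_le_one N η r hL.conjTranspose_mul_self) hG
  nlinarith

theorem Thop_commute_DE (N : ℕ) {η : ℕ} (hη : 1 ≤ η) (x : ℝ) {r s : Fin (N - 1)} (hrs : s ≠ r)
    (i : Fin 4) : Commute (Thop N η x r i) (DE N η s) := by
  obtain ⟨L, G, -, -, hG, hT⟩ := Thop_eq_smul_mul N hη x r i
  rw [hT, DE_eq_diagonal]
  let e : Fin (2 ^ η) → ℂ := fun k => (((k : ℕ) : ℂ) - ((2 ^ (η - 1) : ℕ) : ℂ)) ^ 2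
  exact ((linkOp_commute_diagonal N η hrs L e).mul_left (hG s e)).smul_left _

theorem norm_Thop_commutator_DE_le (N : ℕ) {η : ℕ} (hη : 1 ≤ η) {x : ℝ} (hx : 0 < x)
    (r : Fin (N - 1)) (i : Fin 4) :
    ‖Thop N η x r i * DE N η r - DE N η r * Thop N η x r i‖
      ≤ x / 2 * (2 * ((2 ^ (η - 1) : ℕ) : ℝ) - 1) := by
  obtain ⟨L, G, hL, hG, hGc, hT⟩ := Thop_eq_smul_mul N hη x r i
  have hc : G * DE N η r = DE N η r * G := by
    rw [DE_eq_diagonal]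
    exact hGc r fun k => (((k : ℕ) : ℂ) - ((2 ^ (η - 1) : ℕ) : ℂ)) ^ 2
  have key : Thop N η x r i * DE N η r - DE N η r * Thop N η x r i = ((x : ℂ) / 4) •
      ((linkOp N η r L * DE N η r - DE N η r * linkOp N η r L) * G) := by
    rw [hT, smul_mul_assoc, mul_smul_comm, ← smul_sub, sub_mul, mul_assoc, hc]
    simp only [mul_assoc]
  rw [key, norm_smul, norm_ofReal_div_four hx]
  have := norm_mul_le_of_le (hL.norm_commutator_DE_le N r) hG
  nlinarith

end HoppingTerms

theorem norm_commutator_le {R : Type*} [NormedRing R] {a b : R} {α β : ℝ} (ha : ‖a‖ ≤ α)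
    (hb : ‖b‖ ≤ β) : ‖a * b - b * a‖ ≤ 2 * (α * β) := by
  have := norm_sub_le_of_le (norm_mul_le_of_le ha hb) (norm_mul_le_of_le hb ha)
  linarith [mul_comm α β]

/-- For every `r` with the paper's `1 ≤ r ≤ N-2` (here `r` is the 0-indexed
link and `h` guarantees that `r + 1` is also a valid link index) and all `i, j ∈ {1,2,3,4}`,
`‖[[T_r^(i), T_{r+1}^(j)], D_{r+1}]‖ ≤ x² (μ/2 + Λ + 1/2)`, where `Λ = 2^(η-1)`. -/
theorem double_commutator_T_Tnext_Dnext_bound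
    (N η : ℕ) (hN : 3 ≤ N) (hNeven : Even N) (hη : 1 ≤ η) (x μ : ℝ) (hx : 0 < x) (hμ : 0 ≤ μ)
    (r : Fin (N - 1)) (h : r.1 + 1 < N - 1) (i j : Fin 4) :
    specNorm ((Thop N η x r i * Thop N η x ⟨r.1 + 1, h⟩ j
          - Thop N η x ⟨r.1 + 1, h⟩ j * Thop N η x r i) * Dlink N η μ ⟨r.1 + 1, h⟩
        - Dlink N η μ ⟨r.1 + 1, h⟩ * (Thop N η x r i * Thop N η x ⟨r.1 + 1, h⟩ j
          - Thop N η x ⟨r.1 + 1, h⟩ j * Thop N η x r i)) ≤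
      x ^ 2 * (μ / 2 + ((2 ^ (η - 1) : ℕ) : ℝ) + 1 / 2) := by
  open scoped Matrix.Norms.L2Operator in
  rw [specNorm_eq_norm]
  set s : Fin (N - 1) := ⟨r.1 + 1, h⟩ with hs
  have hsr : s ≠ r := by simp [hs, Fin.ext_iff]
  have hT := norm_Thop_le N hη hx r i
  have hT' := norm_Thop_le N hη hx s j
  have hTE := norm_Thop_commutator_DE_le N hη hx s j
  have hc : Thop N η x r i * DE N η s = DE N η s * Thop N η x r i :=
    Thop_commute_DE N hη x hsr i
  have hM := norm_DM_le N η hμ (siteL s)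
  rw [Dlink]
  generalize Thop N η x r i = S at *
  generalize Thop N η x s j = T at *
  generalize DE N η s = E at *
  generalize DM N η μ (siteL s) = K at *
  have key : (S * T - T * S) * (K + E) - (K + E) * (S * T - T * S)
      = ((S * T - T * S) * K - K * (S * T - T * S))
        + (S * (T * E - E * T) - (T * E - E * T) * S) := by
    have h1 : T * S * E = T * E * S := by rw [mul_assoc, hc, mul_assoc]
    have h2 : E * S * T = S * E * T := by rw [hc]
    simp only [mul_add, add_mul, mul_sub, sub_mul, ← mul_assoc] at *
    rw [h1, h2]
    abel
  rw [key]
  have hmass := norm_commutator_le (norm_commutator_le hT hT') hM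
  have helec := norm_commutator_le hT hTE
  refine (norm_add_le_of_le hmass helec).trans (le_of_sub_nonneg ?_)
  ring_nf
  positivity
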